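/- arXiv:1501.00205 — 5 statements merged into one kernel-verified Lean document; each statement's English description precedes it below -/
import Mathlib

section
/- Let 0 ≤ δ < 2 and let k ∈ ℝ³ with k ≠ 0. Then the function p ↦ ‖k − ‖k‖p‖^{−δ} is integrable on the unit sphere S² with respect to the surface measure σ, and ∫_{S²} ‖k − ‖k‖ p‖^{−δ} dσ(p) = (2^{2−δ} π / (1 − δ/2)) · ‖k‖^{−δ}. -/
open MeasureTheory Real

/-- The surface measure on the unit sphere `S² ⊆ ℝ³` (total mass `4π`). -/
noncomputable def sphereMeasure :
    Measure (Metric.sphere (0 : EuclideanSpace ℝ (Fin 3)) 1) :=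
  (volume : Measure (EuclideanSpace ℝ (Fin 3))).toSphere

/-- The squared norm of the plane pushes Lebesgue measure forward to `π` times Lebesgue measure
on the half-line. -/
theorem map_norm_sq_volume_fin_two :
    (volume : Measure (EuclideanSpace ℝ (Fin 2))).map (fun y => ‖y‖ ^ 2) =
      ENNReal.ofReal π • volume.restrict (Set.Ici 0) := by
  have hm : Measurable fun y : EuclideanSpace ℝ (Fin 2) => ‖y‖ ^ 2 := by fun_prop
  have key : ∀ a b : ℝ, a < b →
      (volume : Measure (EuclideanSpace ℝ (Fin 2))).map (fun y => ‖y‖ ^ 2) (Set.Ico a b) =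
        ENNReal.ofReal π * ENNReal.ofReal (b - max a 0) := by
    intro a b hab
    have hset : (fun y : EuclideanSpace ℝ (Fin 2) => ‖y‖ ^ 2) ⁻¹' Set.Ico a b =
        Metric.ball 0 √b \ Metric.ball 0 √a := by
      ext y
      simp [Real.lt_sqrt (norm_nonneg y), and_comm]
    rw [Measure.map_apply hm measurableSet_Ico, hset,
      measure_sdiff (Metric.ball_subset_ball (Real.sqrt_le_sqrt hab.le))
        measurableSet_ball.nullMeasurableSet measure_ball_lt_top.ne,
      EuclideanSpace.volume_ball_fin_two, EuclideanSpace.volume_ball_fin_two,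
      ← ENNReal.ofReal_pow (Real.sqrt_nonneg _), ← ENNReal.ofReal_pow (Real.sqrt_nonneg _),
      ← ENNReal.ofReal_mul (by positivity), ← ENNReal.ofReal_mul (by positivity),
      ← ENNReal.ofReal_sub _ (by positivity), ← ENNReal.ofReal_mul pi_pos.le, ← sub_mul, mul_comm]
    rcases le_total b 0 with hb | hb
    · rw [Real.sqrt_eq_zero_of_nonpos hb, Real.sqrt_eq_zero_of_nonpos (hab.le.trans hb),
        max_eq_right (hab.le.trans hb), ENNReal.ofReal_of_nonpos
          (mul_nonpos_of_nonneg_of_nonpos pi_pos.le (by linarith))]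
      simp [mul_nonpos_of_nonneg_of_nonpos pi_pos.le hb]
    · rcases le_total a 0 with ha | ha
      · rw [Real.sqrt_eq_zero_of_nonpos ha, Real.sq_sqrt hb, max_eq_right ha]
        simp
      · rw [Real.sq_sqrt ha, Real.sq_sqrt hb, max_eq_left ha]
  refine Measure.ext_of_Ico' _ _ (fun a b hab => ?_) fun a b hab => ?_
  · rw [key a b hab]
    finiteness
  · rw [key a b hab, Measure.smul_apply, smul_eq_mul, Measure.restrict_apply measurableSet_Ico,
      ← Set.Ici_inter_Iio, Set.inter_right_comm, Set.Ici_inter_Ici, Set.Ici_inter_Iio,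
      Real.volume_Ico]

/-- The law of `(⟪e, x⟫, ‖x‖²)` under Lebesgue measure on `ℝ³`, for a unit vector `e`. -/
theorem map_inner_norm_sq_volume_fin_three {e : EuclideanSpace ℝ (Fin 3)} (he : ‖e‖ = 1) :
    (volume : Measure (EuclideanSpace ℝ (Fin 3))).map (fun x => (inner ℝ e x, ‖x‖ ^ 2)) =
      ENNReal.ofReal π •
        (volume : Measure (ℝ × ℝ)).restrict {z | z.1 ^ 2 ≤ z.2} := by
  obtain ⟨b, hb⟩ : ∃ b : OrthonormalBasis (Fin 3) ℝ (EuclideanSpace ℝ (Fin 3)), b 0 = e := by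
    have hon : Orthonormal ℝ (({0} : Set (Fin 3)).domRestrict fun _ => e) := by
      refine ⟨fun _ => he, fun i j hij => (hij (Subsingleton.elim i j)).elim⟩
    obtain ⟨b, hb⟩ := hon.exists_orthonormalBasis_extension_of_card_eq (by simp)
    exact ⟨b, hb 0 rfl⟩
  have hψ := (((MeasurePreserving.id (volume : Measure ℝ)).prod
    (PiLp.volume_preserving_toLp (Fin 2))).comp
      ((volume_preserving_piFinSuccAbove (fun _ : Fin 3 => ℝ) 0).comp
        (PiLp.volume_preserving_ofLp (Fin 3)))).comp b.measurePreserving_repr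
  set ψ := ((Prod.map id (WithLp.toLp 2) ∘
    (MeasurableEquiv.piFinSuccAbove (fun _ : Fin 3 => ℝ) 0) ∘ WithLp.ofLp) ∘ b.repr) with hψdef
  have hfac : (fun x : EuclideanSpace ℝ (Fin 3) => (inner ℝ e x, ‖x‖ ^ 2)) =
      (fun z : ℝ × EuclideanSpace ℝ (Fin 2) => (z.1, z.1 ^ 2 + ‖z.2‖ ^ 2)) ∘ ψ := by
    funext x
    have hnorm : ‖x‖ ^ 2 = b.repr x 0 ^ 2 + (b.repr x 1 ^ 2 + b.repr x 2 ^ 2) := by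
      rw [← b.repr.norm_map x, EuclideanSpace.norm_sq_eq, Fin.sum_univ_three]
      simp only [Real.norm_eq_abs, sq_abs, add_assoc]
    rw [hnorm, ← hb, ← b.repr_apply_apply]
    simp [hψdef, EuclideanSpace.norm_sq_eq, MeasurableEquiv.piFinSuccAbove,
      Fin.insertNthEquiv, Fin.tail]
  have hg : Measurable
      (fun z : ℝ × EuclideanSpace ℝ (Fin 2) => (z.1, z.1 ^ 2 + ‖z.2‖ ^ 2)) := by fun_prop
  rw [hfac, ← Measure.map_map hg hψ.measurable, hψ.map_eq]
  ext T hT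
  have hC : MeasurableSet {z : ℝ × ℝ | z.1 ^ 2 ≤ z.2} :=
    measurableSet_le (by fun_prop) (by fun_prop)
  rw [Measure.map_apply hg hT, Measure.prod_apply (hg hT), Measure.smul_apply, smul_eq_mul,
    Measure.restrict_apply hT, Measure.volume_eq_prod, Measure.prod_apply (hT.inter hC),
    ← lintegral_const_mul _ (measurable_measure_prodMk_left (hT.inter hC))]
  refine lintegral_congr fun s => ?_
  have hTs : MeasurableSet ((fun q : ℝ => (s, s ^ 2 + q)) ⁻¹' T) :=
    (by fun_prop : Measurable fun q : ℝ => (s, s ^ 2 + q)) hT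
  have h1 : Prod.mk s ⁻¹' ((fun z : ℝ × EuclideanSpace ℝ (Fin 2) =>
      (z.1, z.1 ^ 2 + ‖z.2‖ ^ 2)) ⁻¹' T) =
      (fun y : EuclideanSpace ℝ (Fin 2) => ‖y‖ ^ 2) ⁻¹' ((fun q : ℝ => (s, s ^ 2 + q)) ⁻¹' T) :=
    rfl
  have h2 : (fun q : ℝ => (s, s ^ 2 + q)) ⁻¹' T ∩ Set.Ici 0 =
      (fun q => s ^ 2 + q) ⁻¹' (Prod.mk s ⁻¹' (T ∩ {z | z.1 ^ 2 ≤ z.2})) := by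
    ext q
    simp
  rw [h1, ← Measure.map_apply (by fun_prop) hTs, map_norm_sq_volume_fin_two, Measure.smul_apply,
    smul_eq_mul, Measure.restrict_apply hTs, h2, measure_preimage_add]

open scoped Pointwise in
/-- **Archimedes' hat-box theorem**: the height function on the unit sphere of `ℝ³` pushes the
surface measure forward to `2π` times Lebesgue measure on `[-1, 1]`. -/
theorem map_inner_sphereMeasure {e : EuclideanSpace ℝ (Fin 3)} (he : ‖e‖ = 1) :
    sphereMeasure.map (fun p : Metric.sphere (0 : EuclideanSpace ℝ (Fin 3)) 1 =>
      inner ℝ e (p : EuclideanSpace ℝ (Fin 3))) =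
      ENNReal.ofReal (2 * π) • volume.restrict (Set.Icc (-1) 1) := by
  ext S hS
  have hm : Measurable fun p : Metric.sphere (0 : EuclideanSpace ℝ (Fin 3)) 1 =>
    inner ℝ e (p : EuclideanSpace ℝ (Fin 3)) := by fun_prop
  have hm' : Measurable fun x : EuclideanSpace ℝ (Fin 3) => (inner ℝ e x, ‖x‖ ^ 2) := by fun_prop
  set T : Set (ℝ × ℝ) := {z | z.2 ∈ Set.Ioo 0 1 ∧ z.1 * (√z.2)⁻¹ ∈ S} with hTdef
  have hT : MeasurableSet T :=
    (measurable_snd measurableSet_Ioo).inter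
      ((by fun_prop : Measurable fun z : ℝ × ℝ => z.1 * (√z.2)⁻¹) hS)
  have hC : MeasurableSet {z : ℝ × ℝ | z.1 ^ 2 ≤ z.2} :=
    measurableSet_le (by fun_prop) (by fun_prop)
  have hcone : Set.Ioo (0 : ℝ) 1 • (Subtype.val '' ((fun p : Metric.sphere
      (0 : EuclideanSpace ℝ (Fin 3)) 1 => inner ℝ e (p : EuclideanSpace ℝ (Fin 3))) ⁻¹' S)) =
      (fun x : EuclideanSpace ℝ (Fin 3) => (inner ℝ e x, ‖x‖ ^ 2)) ⁻¹' T := by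
    ext x
    simp only [Set.mem_smul, Set.mem_image, Set.mem_preimage, hTdef, Set.mem_ofPred_eq,
      Set.mem_Ioo, Real.sqrt_sq (norm_nonneg x)]
    constructor
    · rintro ⟨r, ⟨hr0, hr1⟩, _, ⟨p, hp, rfl⟩, rfl⟩
      have hp1 : ‖(p : EuclideanSpace ℝ (Fin 3))‖ = 1 := by simp
      rw [norm_smul, hp1, mul_one, Real.norm_of_nonneg hr0.le, inner_smul_right]
      refine ⟨⟨by positivity, by nlinarith⟩, ?_⟩
      rwa [mul_comm r, mul_inv_cancel_right₀ hr0.ne']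
    · rintro ⟨⟨h0, h1⟩, hx⟩
      have hx0 : 0 < ‖x‖ := (norm_nonneg x).lt_of_ne fun h => by simp [← h] at h0
      refine ⟨‖x‖, ⟨hx0, by nlinarith⟩, ‖x‖⁻¹ • x,
        ⟨⟨‖x‖⁻¹ • x, by simp [norm_smul, hx0.ne']⟩, ?_, rfl⟩, smul_inv_smul₀ hx0.ne' x⟩
      rwa [inner_smul_right, mul_comm]
  have hslice : ∀ w : ℝ, volume ((fun s => (s, w)) ⁻¹' (T ∩ {z | z.1 ^ 2 ≤ z.2})) =
      (Set.Ioo (0 : ℝ) 1).indicator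
        (fun w => ENNReal.ofReal √w * volume (S ∩ Set.Icc (-1) 1)) w := by
    intro w
    by_cases hw : w ∈ Set.Ioo (0 : ℝ) 1
    · have hw0 : 0 < √w := Real.sqrt_pos.2 hw.1
      have hset : (fun s => (s, w)) ⁻¹' (T ∩ {z | z.1 ^ 2 ≤ z.2}) =
          (fun s => s * (√w)⁻¹) ⁻¹' (S ∩ Set.Icc (-1) 1) := by
        ext s
        have hs : s ^ 2 ≤ w ↔ s * (√w)⁻¹ ∈ Set.Icc (-1) 1 := by
          rw [Set.mem_Icc, ← abs_le, abs_mul, abs_inv, abs_of_pos hw0, ← div_eq_mul_inv,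
            div_le_one hw0, ← Real.sqrt_sq_eq_abs, Real.sqrt_le_sqrt_iff hw.1.le]
        exact and_congr (and_iff_right hw) hs
      rw [hset, Real.volume_preimage_mul_right (inv_ne_zero hw0.ne'), inv_inv, abs_of_pos hw0,
        Set.indicator_of_mem hw]
    · have hset : (fun s => (s, w)) ⁻¹' (T ∩ {z | z.1 ^ 2 ≤ z.2}) = ∅ := by
        ext s
        simp only [hTdef, Set.mem_preimage, Set.mem_inter_iff, Set.mem_ofPred_eq,
          Set.mem_empty_iff_false, iff_false]
        exact fun h => hw h.1.1
      rw [hset, Set.indicator_of_notMem hw, measure_empty]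
  have hsqrt : ∫⁻ w in Set.Ioo (0 : ℝ) 1, ENNReal.ofReal √w = ENNReal.ofReal (2 / 3) := by
    have hint : IntervalIntegrable (fun w : ℝ => √w) volume 0 1 :=
      Real.continuous_sqrt.intervalIntegrable _ _
    rw [restrict_Ioo_eq_restrict_Ioc, ← ofReal_integral_eq_lintegral_ofReal hint.1
      (Filter.Eventually.of_forall fun w => Real.sqrt_nonneg w),
      ← intervalIntegral.integral_of_le zero_le_one]
    simp_rw [Real.sqrt_eq_rpow]
    rw [integral_rpow (Or.inl (by norm_num))]
    norm_num
  rw [Measure.map_apply hm hS, sphereMeasure, Measure.toSphere_apply' _ (hm hS), hcone,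
    ← Measure.map_apply hm' hT, map_inner_norm_sq_volume_fin_three he, Measure.smul_apply,
    Measure.restrict_apply hT, Measure.volume_eq_prod, Measure.prod_apply_symm (hT.inter hC),
    lintegral_congr hslice, lintegral_indicator measurableSet_Ioo,
    lintegral_mul_const _ (by fun_prop), hsqrt, Measure.smul_apply, Measure.restrict_apply hS]
  simp only [smul_eq_mul, ← mul_assoc, finrank_euclideanSpace, Fintype.card_fin]
  rw [← ENNReal.ofReal_natCast, ← ENNReal.ofReal_mul (by positivity),
    ← ENNReal.ofReal_mul (by positivity)]
  congr 2
  push_cast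
  ring

theorem norm_sub_norm_smul_rpow (δ : ℝ) {k p : EuclideanSpace ℝ (Fin 3)} (hk : k ≠ 0)
    (hp : ‖p‖ = 1) :
    ‖k - ‖k‖ • p‖ ^ (-δ) = ‖k‖ ^ (-δ) * (2 - 2 * inner ℝ (‖k‖⁻¹ • k) p) ^ (-δ / 2) := by
  have hk0 : 0 < ‖k‖ := norm_pos_iff.2 hk
  have hsq : ‖‖k‖⁻¹ • k - p‖ ^ 2 = 2 - 2 * inner ℝ (‖k‖⁻¹ • k) p := by
    rw [norm_sub_sq_real, hp, norm_smul, norm_inv, norm_norm, inv_mul_cancel₀ hk0.ne']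
    ring
  have hfac : k - ‖k‖ • p = ‖k‖ • (‖k‖⁻¹ • k - p) := by
    rw [smul_sub, smul_inv_smul₀ hk0.ne']
  rw [← hsq, ← Real.rpow_natCast_mul (norm_nonneg _), hfac, norm_smul, norm_norm,
    Real.mul_rpow hk0.le (norm_nonneg _)]
  congr 2
  push_cast
  ring

theorem intervalIntegrable_two_sub_two_mul_rpow {r : ℝ} (hr : -1 < r) :
    IntervalIntegrable (fun u : ℝ => (2 - 2 * u) ^ r) volume (-1) 1 := by
  have h := (intervalIntegral.intervalIntegrable_rpow' (a := 4) (b := 0) hr).comp_sub_left 2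
  have h' := h.comp_mul_left (c := 2)
  norm_num at h'
  exact h'

theorem integral_two_sub_two_mul_rpow {r : ℝ} (hr : -1 < r) :
    ∫ u in (-1 : ℝ)..1, (2 - 2 * u) ^ r = 4 ^ (r + 1) / (2 * (r + 1)) := by
  have hr1 : r + 1 ≠ 0 := by linarith
  rw [intervalIntegral.integral_comp_sub_mul (fun v : ℝ => v ^ r) two_ne_zero 2,
    integral_rpow (Or.inl hr), smul_eq_mul]
  norm_num [Real.zero_rpow hr1]
  field_simp

/-- for `0 ≤ δ < 2` and `k ≠ 0`, `p ↦ ‖k − ‖k‖p‖^{−δ}` is integrable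
on `S²` and `∫_{S²} ‖k − ‖k‖p‖^{−δ} dσ(p) = (2^{2−δ}π/(1 − δ/2)) ‖k‖^{−δ}`. -/
theorem sphere_integral_long_range_kernel
    (δ : ℝ) (hδ0 : 0 ≤ δ) (hδ2 : δ < 2)
    (k : EuclideanSpace ℝ (Fin 3)) (hk : k ≠ 0) :
    Integrable
      (fun p : Metric.sphere (0 : EuclideanSpace ℝ (Fin 3)) 1 =>
        ‖k - ‖k‖ • (p : EuclideanSpace ℝ (Fin 3))‖ ^ (-δ)) sphereMeasure ∧
    ∫ p : Metric.sphere (0 : EuclideanSpace ℝ (Fin 3)) 1,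
        ‖k - ‖k‖ • (p : EuclideanSpace ℝ (Fin 3))‖ ^ (-δ) ∂sphereMeasure =
      (2 : ℝ) ^ (2 - δ) * π / (1 - δ / 2) * ‖k‖ ^ (-δ) := by
  have hk0 : 0 < ‖k‖ := norm_pos_iff.2 hk
  have he : ‖‖k‖⁻¹ • k‖ = 1 := by
    rw [norm_smul, norm_inv, norm_norm, inv_mul_cancel₀ hk0.ne']
  have hr : -1 < -δ / 2 := by linarith
  have hm : AEMeasurable (fun p : Metric.sphere (0 : EuclideanSpace ℝ (Fin 3)) 1 =>
      inner ℝ (‖k‖⁻¹ • k) (p : EuclideanSpace ℝ (Fin 3))) sphereMeasure := by fun_prop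
  have hg : Measurable fun u : ℝ => (2 - 2 * u) ^ (-δ / 2) := by fun_prop
  have hpt : (fun p : Metric.sphere (0 : EuclideanSpace ℝ (Fin 3)) 1 =>
      ‖k - ‖k‖ • (p : EuclideanSpace ℝ (Fin 3))‖ ^ (-δ)) = fun p : Metric.sphere (0 : EuclideanSpace ℝ (Fin 3)) 1 =>
      ‖k‖ ^ (-δ) * (2 - 2 * inner ℝ (‖k‖⁻¹ • k) (p : EuclideanSpace ℝ (Fin 3))) ^ (-δ / 2) :=
    funext fun p => norm_sub_norm_smul_rpow δ hk (by simp)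
  rw [hpt]
  constructor
  · refine Integrable.const_mul ?_ _
    refine (integrable_map_measure hg.aestronglyMeasurable hm).1 ?_
    rw [map_inner_sphereMeasure he]
    refine Integrable.smul_measure ?_ ENNReal.ofReal_ne_top
    exact (intervalIntegrable_iff_integrableOn_Icc_of_le (by norm_num)).1
      (intervalIntegrable_two_sub_two_mul_rpow hr)
  · rw [integral_const_mul, ← integral_map hm hg.aestronglyMeasurable,
      map_inner_sphereMeasure he, integral_smul_measure, integral_Icc_eq_integral_Ioc,
      ← intervalIntegral.integral_of_le (by norm_num), integral_two_sub_two_mul_rpow hr,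
      ENNReal.toReal_ofReal (by positivity), smul_eq_mul]
    have h4 : (4 : ℝ) ^ (-δ / 2 + 1) = 2 ^ (2 - δ) := by
      rw [show (4 : ℝ) = 2 ^ (2 : ℝ) by norm_num, ← Real.rpow_mul zero_le_two]
      congr 1
      ring
    have h1 : 1 - δ / 2 ≠ 0 := by linarith
    have h2 : -δ / 2 + 1 = 1 - δ / 2 := by ring
    rw [h4, h2]
    field_simp
end

section
/- Let 0 < δ < 2 and a > 0. Then the function x ↦ (1 − cos(a‖x‖)) · ‖x‖^{δ−5} is integrable on ℝ³, and ∫_{ℝ³} (1 − cos(a‖x‖)) ‖x‖^{δ−5} dx = 4π a^{2−δ} ∫₀^∞ (1 − cos r) r^{δ−3} dr, where the one-dimensional integral on the right converges. -/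
open MeasureTheory Real

/-- The radial integrand is integrable near `0` since `1 - cos r ≤ r ^ 2 / 2`, and near `∞` since
`1 - cos r ≤ 2`. -/
theorem integrableOn_one_sub_cos_mul_rpow {δ : ℝ} (hδ0 : 0 < δ) (hδ2 : δ < 2) :
    IntegrableOn (fun r : ℝ => (1 - Real.cos r) * r ^ (δ - 3)) (Set.Ioi 0) := by
  have hmeas : Measurable (fun r : ℝ => (1 - Real.cos r) * r ^ (δ - 3)) := by fun_prop
  rw [← Set.Ioc_union_Ioi_eq_Ioi (zero_le_one' ℝ)]
  refine IntegrableOn.union ?_ ?_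
  · have h : IntegrableOn (fun r : ℝ => r ^ (δ - 1)) (Set.Ioc 0 1) :=
      (intervalIntegral.intervalIntegrable_rpow' (by linarith)).1
    refine Integrable.mono' h hmeas.aestronglyMeasurable ?_
    filter_upwards [ae_restrict_mem measurableSet_Ioc] with r hr
    have hr0 : 0 < r := hr.1
    have hp : 0 ≤ r ^ (δ - 3) := rpow_nonneg hr0.le _
    rw [Real.norm_of_nonneg (mul_nonneg (by linarith [cos_le_one r]) hp)]
    have heq : r ^ (δ - 1) = r ^ 2 * r ^ (δ - 3) := by
      rw [← rpow_natCast, ← rpow_add hr0]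
      congr 1
      push_cast
      ring
    rw [heq]
    exact mul_le_mul_of_nonneg_right
      (by nlinarith [one_sub_sq_div_two_le_cos (x := r)]) hp
  · have h : IntegrableOn (fun r : ℝ => 2 * r ^ (δ - 3)) (Set.Ioi 1) :=
      (integrableOn_Ioi_rpow_of_lt (by linarith) one_pos).const_mul 2
    refine Integrable.mono' h hmeas.aestronglyMeasurable ?_
    filter_upwards [ae_restrict_mem measurableSet_Ioi] with r hr
    have hr0 : 0 < r := one_pos.trans hr
    have hp : 0 ≤ r ^ (δ - 3) := rpow_nonneg hr0.le _
    rw [Real.norm_of_nonneg (mul_nonneg (by linarith [cos_le_one r]) hp)]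
    exact mul_le_mul_of_nonneg_right (by linarith [neg_one_le_cos r]) hp

/-- The radial density in polar coordinates on `ℝ³` is a rescaled copy of the integrand at
`a = 1`. -/
theorem sq_mul_one_sub_cos_mul_rpow (δ : ℝ) {a r : ℝ} (ha : 0 < a) (hr : 0 < r) :
    r ^ 2 * ((1 - Real.cos (a * r)) * r ^ (δ - 5)) =
      a ^ (3 - δ) * ((1 - Real.cos (a * r)) * (a * r) ^ (δ - 3)) := by
  have h1 : r ^ (δ - 3) = r ^ 2 * r ^ (δ - 5) := by
    rw [← rpow_natCast, ← rpow_add hr]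
    congr 1
    push_cast
    ring
  have h2 : a ^ (3 - δ) * a ^ (δ - 3) = 1 := by
    rw [← rpow_add ha]
    simp
  rw [mul_rpow ha.le hr.le, h1]
  linear_combination (-(1 - Real.cos (a * r)) * (r ^ 2 * r ^ (δ - 5))) * h2

/-- for `0 < δ < 2` and `a > 0`, `x ↦ (1 − cos(a‖x‖))‖x‖^{δ−5}` is
integrable on `ℝ³`, the radial integral `∫₀^∞ (1 − cos r) r^{δ−3} dr` converges, and
`∫_{ℝ³} (1 − cos(a‖x‖))‖x‖^{δ−5} dx = 4π a^{2−δ} ∫₀^∞ (1 − cos r) r^{δ−3} dr`. -/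
theorem long_range_absorption_integral
    (δ : ℝ) (hδ0 : 0 < δ) (hδ2 : δ < 2) (a : ℝ) (ha : 0 < a) :
    Integrable (fun x : EuclideanSpace ℝ (Fin 3) =>
      (1 - Real.cos (a * ‖x‖)) * ‖x‖ ^ (δ - 5)) ∧
    IntegrableOn (fun r : ℝ => (1 - Real.cos r) * r ^ (δ - 3)) (Set.Ioi 0) ∧
    ∫ x : EuclideanSpace ℝ (Fin 3), (1 - Real.cos (a * ‖x‖)) * ‖x‖ ^ (δ - 5) =
      4 * π * a ^ (2 - δ) * ∫ r in Set.Ioi (0 : ℝ), (1 - Real.cos r) * r ^ (δ - 3) := by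
  have hI := integrableOn_one_sub_cos_mul_rpow hδ0 hδ2
  refine ⟨?_, hI, ?_⟩
  · refine (integrable_fun_norm_addHaar volume
      (f := fun r : ℝ => (1 - Real.cos (a * r)) * r ^ (δ - 5))).2 ?_
    have hscaled : IntegrableOn
        (fun r : ℝ => (1 - Real.cos (a * r)) * (a * r) ^ (δ - 3)) (Set.Ioi 0) :=
      (integrableOn_Ioi_comp_mul_left_iff
        (fun r : ℝ => (1 - Real.cos r) * r ^ (δ - 3)) 0 ha).2 (by simpa using hI)
    refine IntegrableOn.congr_fun (hscaled.const_mul (a ^ (3 - δ))) (fun r hr => ?_)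
      measurableSet_Ioi
    simpa using (sq_mul_one_sub_cos_mul_rpow δ ha hr).symm
  · have hball : volume.real (Metric.ball (0 : EuclideanSpace ℝ (Fin 3)) 1) = π * 4 / 3 := by
      rw [measureReal_def, EuclideanSpace.volume_ball_fin_three, ENNReal.ofReal_one, one_pow,
        one_mul, ENNReal.toReal_ofReal (by positivity)]
    have hradial : ∫ r in Set.Ioi (0 : ℝ), r ^ 2 * ((1 - Real.cos (a * r)) * r ^ (δ - 5)) =
        a ^ (2 - δ) * ∫ r in Set.Ioi (0 : ℝ), (1 - Real.cos r) * r ^ (δ - 3) := by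
      rw [setIntegral_congr_fun measurableSet_Ioi
          (fun r hr => sq_mul_one_sub_cos_mul_rpow δ ha hr), integral_const_mul,
        integral_comp_mul_left_Ioi (fun r : ℝ => (1 - Real.cos r) * r ^ (δ - 3)) 0 ha,
        mul_zero, smul_eq_mul, ← mul_assoc, ← rpow_neg_one, ← rpow_add ha]
      ring_nf
    rw [integral_fun_norm_addHaar volume
      (fun r : ℝ => (1 - Real.cos (a * r)) * r ^ (δ - 5)), hball, finrank_euclideanSpace_fin]
    simp only [smul_eq_mul, nsmul_eq_mul, Nat.add_one_sub_one, hradial]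
    push_cast
    ring
end

section
/- For every δ with 0 < δ < 1, the double integral ∫_{‖ξ₁‖ ≥ 1} ∫_{‖ξ₂‖ ≥ 1} ‖ξ₁ − ξ₂‖^{δ−3} ‖ξ₁‖^{−2} ‖ξ₂‖^{−2} dξ₁ dξ₂, taken over pairs (ξ₁, ξ₂) ∈ ℝ³ × ℝ³ with ‖ξ₁‖ ≥ 1 and ‖ξ₂‖ ≥ 1, is finite. -/
open MeasureTheory Real

theorem rpow_neg_le_two_rpow_mul_one_add_rpow_neg {p s : ℝ} (hp : 0 ≤ p) (hs : 1 ≤ s) :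
    s ^ (-p) ≤ 2 ^ p * (1 + s) ^ (-p) := by
  have h : (1 + s) ^ p ≤ 2 ^ p * s ^ p := by
    rw [← mul_rpow (by norm_num) (by linarith)]
    exact rpow_le_rpow (by linarith) (by linarith) hp
  rw [rpow_neg (by linarith), rpow_neg (by linarith), ← div_eq_mul_inv,
    le_div_iff₀ (by positivity), inv_mul_le_iff₀ (by positivity), mul_comm]
  exact h

theorem rpow_neg_mul_rpow_neg_le_add {a b α q : ℝ} (ha : 0 < a) (hb : 0 < b) (hα : 0 ≤ α)
    (hq : 0 ≤ q) :
    a ^ (-α) * b ^ (-q) ≤ a ^ (-(α + q)) + b ^ (-(α + q)) := by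
  rw [neg_add, rpow_add ha, rpow_add hb]
  rcases le_total a b with h | h
  · have := mul_le_mul_of_nonneg_left (rpow_le_rpow_of_nonpos ha h (neg_nonpos.2 hq))
      (rpow_nonneg ha.le (-α))
    exact this.trans (le_add_of_nonneg_right (by positivity))
  · have := mul_le_mul_of_nonneg_right (rpow_le_rpow_of_nonpos hb h (neg_nonpos.2 hα))
      (rpow_nonneg hb.le (-q))
    exact this.trans (le_add_of_nonneg_left (by positivity))

theorem rpow_neg_mul_rpow_neg_le_indicator_add {t b α q : ℝ} (ht : 0 ≤ t) (hb : 1 ≤ b)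
    (hα : 0 ≤ α) (hq : 0 ≤ q) :
    t ^ (-α) * b ^ (-q) ≤ (Set.Iio 1).indicator (fun s : ℝ => s ^ (-α)) t
      + 2 ^ (α + q) * (1 + t) ^ (-(α + q)) + 2 ^ (α + q) * (1 + b) ^ (-(α + q)) := by
  rcases lt_or_ge t 1 with h | h
  · rw [Set.indicator_of_mem (Set.mem_Iio.2 h)]
    have := mul_le_mul_of_nonneg_left (rpow_le_one_of_one_le_of_nonpos hb (neg_nonpos.2 hq))
      (rpow_nonneg ht (-α))
    have h₁ : 0 ≤ (2 : ℝ) ^ (α + q) * (1 + t) ^ (-(α + q)) := by positivity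
    have h₂ : 0 ≤ (2 : ℝ) ^ (α + q) * (1 + b) ^ (-(α + q)) := by positivity
    linarith
  · rw [Set.indicator_of_notMem (by simpa using h), zero_add]
    have hαq : 0 ≤ α + q := add_nonneg hα hq
    exact (rpow_neg_mul_rpow_neg_le_add (by linarith) (by linarith) hα hq).trans
      (add_le_add (rpow_neg_le_two_rpow_mul_one_add_rpow_neg hαq h)
        (rpow_neg_le_two_rpow_mul_one_add_rpow_neg hαq hb))

/-- Weighted form of the arithmetic-geometric mean inequality for negative powers. -/
theorem rpow_neg_mul_rpow_neg_le_mul_add_mul {a b β p q : ℝ} (ha : 0 < a) (hb : 0 < b)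
    (hpq : p + q = 2 * β) :
    a ^ (-β) * b ^ (-β) ≤ a ^ (-q) * b ^ (-p) + b ^ (-q) * a ^ (-p) := by
  have key (x : ℝ) (hx : 0 < x) : x ^ (-q) = x ^ (-q / 2) * x ^ (-q / 2) ∧
      x ^ (-p) = x ^ (-p / 2) * x ^ (-p / 2) ∧ x ^ (-β) = x ^ (-q / 2) * x ^ (-p / 2) := by
    refine ⟨?_, ?_, ?_⟩ <;> rw [← rpow_add hx] <;> congr 1 <;> linarith
  obtain ⟨a₁, a₂, a₃⟩ := key a ha
  obtain ⟨b₁, b₂, b₃⟩ := key b hb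
  rw [a₁, a₂, a₃, b₁, b₂, b₃]
  have : 0 ≤ (a ^ (-q / 2) * b ^ (-p / 2)) * (b ^ (-q / 2) * a ^ (-p / 2)) := by positivity
  nlinarith [sq_nonneg (a ^ (-q / 2) * b ^ (-p / 2) - b ^ (-q / 2) * a ^ (-p / 2))]

section

variable {E : Type*} [NormedAddCommGroup E] [NormedSpace ℝ E] [FiniteDimensional ℝ E]
  [MeasurableSpace E] [BorelSpace E] (μ : Measure E) [μ.IsAddHaarMeasure]

theorem integrable_indicator_norm_rpow_neg {α : ℝ} (hα₀ : 0 ≤ α)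
    (hα : α < Module.finrank ℝ E) :
    Integrable (fun x : E => (Set.Iio 1).indicator (fun s : ℝ => s ^ (-α)) ‖x‖) μ := by
  have hd : 1 ≤ Module.finrank ℝ E := by
    have : (0 : ℝ) < Module.finrank ℝ E := hα₀.trans_lt hα
    exact_mod_cast this
  have hloc : LocallyIntegrable (fun x : E => ‖x‖ ^ (-α)) μ :=
    locallyIntegrable_of_norm_le_rpow (C := 1) hd hα
      (.of_forall fun x => by
        rw [one_mul, norm_of_nonneg (by positivity)])
      (measurable_norm.pow_const _).aestronglyMeasurable
  have hball := (hloc.integrableOn_isCompact (isCompact_closedBall (0 : E) 1)).mono_set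
    Metric.ball_subset_closedBall
  refine (hball.integrable_indicator Metric.isOpen_ball.measurableSet).congr
    (.of_forall fun x => ?_)
  simp [Set.indicator, Metric.mem_ball]

/-- A diagonal case of the Hardy–Littlewood–Sobolev bound, away from the origin. -/
theorem integrableOn_norm_sub_rpow_mul_norm_rpow_mul_norm_rpow {α β : ℝ} (hα₀ : 0 ≤ α)
    (hα : α < Module.finrank ℝ E) (hαβ : 2 * (Module.finrank ℝ E : ℝ) < α + 2 * β) :
    IntegrableOn (fun ξ : E × E => ‖ξ.1 - ξ.2‖ ^ (-α) * ‖ξ.1‖ ^ (-β) * ‖ξ.2‖ ^ (-β))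
      {ξ : E × E | 1 ≤ ‖ξ.1‖ ∧ 1 ≤ ‖ξ.2‖} (μ.prod μ) := by
  obtain ⟨q, hq₁, hq₂⟩ := exists_between
    (show (Module.finrank ℝ E : ℝ) - α < 2 * β - Module.finrank ℝ E by linarith)
  obtain ⟨p, hpq⟩ : ∃ p, p + q = 2 * β := ⟨2 * β - q, by ring⟩
  have hq₀ : 0 ≤ q := by linarith
  have hp : (Module.finrank ℝ E : ℝ) < p := by linarith
  have hp₀ : 0 ≤ p := by linarith
  have hr : (Module.finrank ℝ E : ℝ) < α + q := by linarith
  let k : E → ℝ := fun z => (Set.Iio 1).indicator (fun s : ℝ => s ^ (-α)) ‖z‖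
    + 2 ^ (α + q) * (1 + ‖z‖) ^ (-(α + q))
  let u : E → ℝ := fun z => 2 ^ (α + q) * (1 + ‖z‖) ^ (-(α + q))
  let w : E → ℝ := fun z => 2 ^ p * (1 + ‖z‖) ^ (-p)
  have hu : Integrable u μ := (integrable_one_add_norm hr).const_mul _
  have hk : Integrable k μ := (integrable_indicator_norm_rpow_neg μ hα₀ hα).add hu
  have hw : Integrable w μ := (integrable_one_add_norm hp).const_mul _
  let G : E × E → ℝ := fun ξ => w ξ.2 * k (ξ.1 - ξ.2) + u ξ.1 * w ξ.2
  have hG : Integrable G (μ.prod μ) :=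
    (hw.convolution_integrand (ContinuousLinearMap.mul ℝ ℝ) hk).add (hu.mul_prod hw)
  have bound (x y : E) (hx : 1 ≤ ‖x‖) (hy : 1 ≤ ‖y‖) :
      ‖x - y‖ ^ (-α) * (‖x‖ ^ (-q) * ‖y‖ ^ (-p)) ≤ G (x, y) := by
    have h₁ := rpow_neg_mul_rpow_neg_le_indicator_add (norm_nonneg (x - y)) hx hα₀ hq₀
    have h₂ := rpow_neg_le_two_rpow_mul_one_add_rpow_neg hp₀ hy
    calc _ = (‖x - y‖ ^ (-α) * ‖x‖ ^ (-q)) * ‖y‖ ^ (-p) := by ring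
      _ ≤ (k (x - y) + u x) * w y := mul_le_mul h₁ h₂ (by positivity) (le_trans (by positivity) h₁)
      _ = _ := by simp only [G]; ring
  refine Integrable.mono' (hG.add hG.swap).integrableOn (by fun_prop) ?_
  refine ae_restrict_of_forall_mem ?_ ?_
  · exact (measurableSet_le measurable_const measurable_fst.norm).inter
      (measurableSet_le measurable_const measurable_snd.norm)
  · rintro ⟨x, y⟩ ⟨hx, hy⟩
    have hx' : 1 ≤ ‖x‖ := hx
    have hy' : 1 ≤ ‖y‖ := hy
    rw [norm_of_nonneg (by positivity)]
    have h := mul_le_mul_of_nonneg_left (rpow_neg_mul_rpow_neg_le_mul_add_mul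
      (a := ‖x‖) (b := ‖y‖) (by linarith) (by linarith) hpq)
      (rpow_nonneg (norm_nonneg (x - y)) (-α))
    have hxy := bound x y hx hy
    have hyx := bound y x hy hx
    rw [norm_sub_rev] at hyx
    simp only [Pi.add_apply, Function.comp_apply, Prod.swap_prod_mk]
    linarith

end

/-- for `0 < δ < 1`, the double integral
`∫_{‖ξ₁‖≥1} ∫_{‖ξ₂‖≥1} ‖ξ₁−ξ₂‖^{δ−3} ‖ξ₁‖^{−2} ‖ξ₂‖^{−2} dξ₁ dξ₂` is finite. -/
theorem double_integral_finite_far_field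
    (δ : ℝ) (hδ0 : 0 < δ) (hδ1 : δ < 1) :
    IntegrableOn
      (fun ξ : EuclideanSpace ℝ (Fin 3) × EuclideanSpace ℝ (Fin 3) =>
        ‖ξ.1 - ξ.2‖ ^ (δ - 3) * ‖ξ.1‖ ^ (-(2 : ℝ)) * ‖ξ.2‖ ^ (-(2 : ℝ)))
      {ξ : EuclideanSpace ℝ (Fin 3) × EuclideanSpace ℝ (Fin 3) |
        1 ≤ ‖ξ.1‖ ∧ 1 ≤ ‖ξ.2‖} := by
  have hd : (Module.finrank ℝ (EuclideanSpace ℝ (Fin 3)) : ℝ) = 3 := by simp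
  have h := integrableOn_norm_sub_rpow_mul_norm_rpow_mul_norm_rpow
    (volume : Measure (EuclideanSpace ℝ (Fin 3))) (α := 3 - δ) (β := 2)
    (by linarith) (by linarith) (by linarith)
  rwa [neg_sub] at h
end

section
/- For every δ with 1 < δ < 2, the double integral ∫_{‖ξ₁‖ ≤ 1} ∫_{‖ξ₂‖ ≤ 1} ‖ξ₁ − ξ₂‖^{δ−3} ‖ξ₁‖^{−2} ‖ξ₂‖^{−2} dξ₁ dξ₂, taken over pairs (ξ₁, ξ₂) ∈ ℝ³ × ℝ³ with ‖ξ₁‖ ≤ 1 and ‖ξ₂‖ ≤ 1 (both nonzero), is finite. -/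
open MeasureTheory Real

/-- A weighted AM-GM bound: `(2, 2, α)` lies in the convex hull of
`(s, s, 0)`, `(s, 0, s)` and `(0, s, s)`, where `s = 2 + α / 2`. -/
theorem rpow_mul_rpow_mul_rpow_le_pairwise_sum {a b c α : ℝ} (ha : 0 < a) (hb : 0 < b)
    (hc : 0 < c) (hα : 0 ≤ α) (hα4 : α ≤ 4) :
    c ^ (-α) * a ^ (-(2 : ℝ)) * b ^ (-(2 : ℝ)) ≤
      a ^ (-(2 + α / 2)) * b ^ (-(2 + α / 2)) + a ^ (-(2 + α / 2)) * c ^ (-(2 + α / 2)) +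
        b ^ (-(2 + α / 2)) * c ^ (-(2 + α / 2)) := by
  set s := 2 + α / 2 with hs
  have hs0 : 0 < s := by positivity
  set w := α / (2 * s) with hw
  have hw0 : 0 ≤ w := by positivity
  have hsw : s * w = α / 2 := by rw [hw]; field_simp
  have hw2 : w ≤ 1 / 2 := by
    rw [hw, div_le_div_iff₀ (by positivity) (by norm_num)]; linarith
  have hA := rpow_pos_of_pos ha (-s)
  have hB := rpow_pos_of_pos hb (-s)
  have hC := rpow_pos_of_pos hc (-s)
  have key := geom_mean_le_arith_mean3_weighted (w₁ := 1 - 2 * w) (w₂ := w) (w₃ := w)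
    (by linarith) hw0 hw0 (mul_pos hA hB).le (mul_pos hA hC).le (mul_pos hB hC).le (by ring)
  have e : (a ^ (-s) * b ^ (-s)) ^ (1 - 2 * w) * (a ^ (-s) * c ^ (-s)) ^ w *
      (b ^ (-s) * c ^ (-s)) ^ w = c ^ (-α) * a ^ (-(2 : ℝ)) * b ^ (-(2 : ℝ)) := by
    rw [mul_rpow hA.le hB.le, mul_rpow hA.le hC.le, mul_rpow hB.le hC.le]
    simp only [← rpow_mul ha.le, ← rpow_mul hb.le, ← rpow_mul hc.le]
    have h2 : -(2 : ℝ) = -s * (1 - 2 * w) + -s * w := by linarith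
    have hα' : -α = -s * w + -s * w := by linarith
    rw [h2, hα', rpow_add ha, rpow_add hb, rpow_add hc]
    ring
  rw [e] at key
  refine key.trans (add_le_add (add_le_add ?_ ?_) ?_)
  · exact mul_le_of_le_one_left (mul_pos hA hB).le (by linarith)
  · exact mul_le_of_le_one_left (mul_pos hA hC).le (by linarith)
  · exact mul_le_of_le_one_left (mul_pos hB hC).le (by linarith)

/-- for `1 < δ < 2`, the double integral
`∫_{‖ξ₁‖≤1} ∫_{‖ξ₂‖≤1} ‖ξ₁−ξ₂‖^{δ−3} ‖ξ₁‖^{−2} ‖ξ₂‖^{−2} dξ₁ dξ₂` (over nonzero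
`ξ₁, ξ₂`) is finite. -/
theorem double_integral_finite_near_field
    (δ : ℝ) (hδ1 : 1 < δ) (hδ2 : δ < 2) :
    IntegrableOn
      (fun ξ : EuclideanSpace ℝ (Fin 3) × EuclideanSpace ℝ (Fin 3) =>
        ‖ξ.1 - ξ.2‖ ^ (δ - 3) * ‖ξ.1‖ ^ (-(2 : ℝ)) * ‖ξ.2‖ ^ (-(2 : ℝ)))
      {ξ : EuclideanSpace ℝ (Fin 3) × EuclideanSpace ℝ (Fin 3) |
        (‖ξ.1‖ ≤ 1 ∧ ‖ξ.2‖ ≤ 1) ∧ ξ.1 ≠ 0 ∧ ξ.2 ≠ 0} := by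
  set E := EuclideanSpace ℝ (Fin 3)
  set s : ℝ := 2 + (3 - δ) / 2 with hs
  set F : E → ℝ := (Metric.closedBall 0 2).indicator fun x => ‖x‖ ^ (-s) with hF
  have hF0 (x : E) : 0 ≤ F x := Set.indicator_nonneg (fun _ _ => by positivity) x
  have hFx (x : E) (hx : ‖x‖ ≤ 2) : F x = ‖x‖ ^ (-s) :=
    Set.indicator_of_mem (by simpa using hx) _
  have hFint : Integrable F := by
    rw [hF, integrable_indicator_iff Metric.isClosed_closedBall.measurableSet]
    have hd : Module.finrank ℝ E = 3 := finrank_euclideanSpace_fin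
    refine (locallyIntegrable_of_norm_le_rpow (C := 1) (α := s) (by simp [hd]) ?_ ?_
      (measurable_norm.pow_const _).aestronglyMeasurable).integrableOn_isCompact
        (isCompact_closedBall 0 2)
    · rw [hd]
      push_cast
      linarith
    · exact ae_of_all _ fun x => by rw [Real.norm_of_nonneg (by positivity), one_mul]
  have hxy : Integrable fun p : E × E => F p.1 * F p.2 := hFint.mul_prod hFint
  have hyz : Integrable fun p : E × E => F p.2 * F (p.1 - p.2) :=
    hFint.convolution_integrand (ContinuousLinearMap.mul ℝ ℝ) hFint
  have hFneg (x : E) : F (-x) = F x := by simp [hF, Set.indicator]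
  have hxz : Integrable fun p : E × E => F p.1 * F (p.1 - p.2) := by
    refine hyz.swap.congr (ae_of_all _ fun p => ?_)
    simp [← hFneg (p.1 - p.2)]
  have hmeas : MeasurableSet {ξ : E × E | (‖ξ.1‖ ≤ 1 ∧ ‖ξ.2‖ ≤ 1) ∧ ξ.1 ≠ 0 ∧ ξ.2 ≠ 0} := by
    measurability
  refine ((hxy.add hxz).add hyz).integrableOn.mono' (by fun_prop) ?_
  filter_upwards [ae_restrict_mem hmeas] with p ⟨⟨h1, h2⟩, h3, h4⟩
  rw [Real.norm_of_nonneg (by positivity)]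
  simp only [Pi.add_apply]
  rcases eq_or_ne (p.1 - p.2) 0 with h | h
  · rw [h, norm_zero, zero_rpow (by linarith), zero_mul, zero_mul]
    have := hF0 p.1
    have := hF0 p.2
    have := hF0 0
    positivity
  · rw [hFx p.1 (by linarith), hFx p.2 (by linarith),
      hFx (p.1 - p.2) ((norm_sub_le _ _).trans (by linarith)), ← neg_sub 3 δ]
    exact rpow_mul_rpow_mul_rpow_le_pairwise_sum (norm_pos_iff.2 h3) (norm_pos_iff.2 h4)
      (norm_pos_iff.2 h) (by linarith) (by linarith)
end

section
/- Let Φ : ℝ³ → ℂ be integrable. Then lim_{ε → 0⁺} ∫_{ℝ³} cos²(‖k‖/ε) · Φ(k) dk = (1/2) ∫_{ℝ³} Φ(k) dk. -/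
open MeasureTheory Real Filter

/-- Integration in polar coordinates of an integrable function with respect to a Haar measure. -/
theorem integral_eq_integral_Ioi_pow_smul_integral_toSphere {E F : Type*}
    [NormedAddCommGroup E] [NormedSpace ℝ E] [FiniteDimensional ℝ E] [Nontrivial E]
    [MeasurableSpace E] [BorelSpace E] [NormedAddCommGroup F] [NormedSpace ℝ F]
    (μ : Measure E) [μ.IsAddHaarMeasure] {f : E → F} (hf : Integrable f μ) :
    ∫ x, f x ∂μ = ∫ r in Set.Ioi (0 : ℝ),
      r ^ (Module.finrank ℝ E - 1) • ∫ ω, f (r • (ω : E)) ∂μ.toSphere := by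
  have hmp := μ.measurePreserving_homeomorphUnitSphereProd
  have hemb := (homeomorphUnitSphereProd E).measurableEmbedding
  let g : Metric.sphere (0 : E) 1 × Set.Ioi (0 : ℝ) → F := fun p => f (p.2.1 • p.1.1)
  have hg : g ∘ homeomorphUnitSphereProd E = fun x => f x.1 := by
    funext x
    have h := congrArg Subtype.val ((homeomorphUnitSphereProd E).symm_apply_apply x)
    rw [homeomorphUnitSphereProd_symm_apply_coe] at h
    exact congrArg f h
  have hint : Integrable g (μ.toSphere.prod (.volumeIoiPow (Module.finrank ℝ E - 1))) := by
    rw [← hmp.integrable_comp_emb hemb, hg]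
    exact (integrableOn_iff_comap_subtypeVal (measurableSet_singleton _).compl).1 hf.integrableOn
  calc
    ∫ x, f x ∂μ = ∫ x : ({(0)}ᶜ : Set E), f x.1 ∂(μ.comap (↑)) := by
      rw [integral_subtype_comap (measurableSet_singleton _).compl f,
        restrict_compl_singleton]
    _ = ∫ p, g p ∂μ.toSphere.prod (.volumeIoiPow (Module.finrank ℝ E - 1)) := by
      rw [← hmp.integral_comp hemb g]
      exact congrArg (fun h => ∫ x, h x ∂(μ.comap (↑))) hg.symm
    _ = ∫ r : Set.Ioi (0 : ℝ), (∫ ω, f (r.1 • (ω : E)) ∂μ.toSphere)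
          ∂.volumeIoiPow (Module.finrank ℝ E - 1) := integral_prod_symm g hint
    _ = _ := by
      simp only [Measure.volumeIoiPow, ENNReal.ofReal]
      rw [integral_withDensity_eq_integral_smul,
        integral_subtype_comap measurableSet_Ioi fun a : ℝ =>
          Real.toNNReal (a ^ (Module.finrank ℝ E - 1)) • ∫ ω, f (a • (ω : E)) ∂μ.toSphere,
        setIntegral_congr_fun measurableSet_Ioi fun x hx => ?_]
      · rw [NNReal.smul_def, Real.coe_toNNReal _ (pow_nonneg (le_of_lt hx) _)]
      · exact (measurable_subtype_coe.pow_const _).real_toNNReal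

/-- Multiplication by a radial phase preserves integrability. -/
theorem integrable_fourierChar_norm_smul {E F : Type*} [NormedAddCommGroup E]
    [MeasurableSpace E] [OpensMeasurableSpace E] [NormedAddCommGroup F] [NormedSpace ℂ F]
    {μ : Measure E} {f : E → F} (hf : Integrable f μ) (w : ℝ) :
    Integrable (fun x => Real.fourierChar (-(‖x‖ * w)) • f x) μ := by
  have hcont : Continuous fun r : ℝ => Real.fourierChar (-(r * w)) := by fun_prop
  refine hf.congr' ?_ (by simp)
  exact (hcont.stronglyMeasurable.comp_measurable measurable_norm).aestronglyMeasurable.smul hf.1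

/-- Riemann-Lebesgue lemma for the radial phase `‖x‖`. -/
theorem tendsto_integral_fourierChar_norm_smul_cocompact {E F : Type*}
    [NormedAddCommGroup E] [NormedSpace ℝ E] [FiniteDimensional ℝ E] [Nontrivial E]
    [MeasurableSpace E] [BorelSpace E] [NormedAddCommGroup F] [NormedSpace ℂ F]
    (μ : Measure E) [μ.IsAddHaarMeasure] {f : E → F} (hf : Integrable f μ) :
    Tendsto (fun w : ℝ => ∫ x, Real.fourierChar (-(‖x‖ * w)) • f x ∂μ) (cocompact ℝ) (nhds 0) := by
  convert Real.tendsto_integral_exp_smul_cocompact ((Set.Ioi (0 : ℝ)).indicator fun r =>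
    r ^ (Module.finrank ℝ E - 1) • ∫ ω, f (r • (ω : E)) ∂μ.toSphere) using 2 with w
  rw [integral_eq_integral_Ioi_pow_smul_integral_toSphere μ
      (integrable_fourierChar_norm_smul hf w),
    ← integral_indicator measurableSet_Ioi]
  congr 1 with r
  by_cases hr : r ∈ Set.Ioi (0 : ℝ)
  · have h (ω : Metric.sphere (0 : E) 1) : ‖r • (ω : E)‖ = r := by
      simp [norm_smul, abs_of_pos (Set.mem_Ioi.1 hr)]
    simp only [Set.indicator_of_mem hr, h, Circle.smul_def]
    rw [integral_smul, smul_comm]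
  · simp [Set.indicator_of_notMem hr]

theorem cos_sq_div_eq_fourierChar (r ε : ℝ) :
    ((Real.cos (r / ε) ^ 2 : ℝ) : ℂ) =
      1 / 2 + 1 / 4 * ((Real.fourierChar (-(r * (π * ε)⁻¹)) : ℂ) +
        (Real.fourierChar (-(r * -(π * ε)⁻¹)) : ℂ)) := by
  have h₁ : ((2 * π * -(r * (π * ε)⁻¹) : ℝ) : ℂ) * Complex.I = -(2 * (r / ε : ℂ)) * Complex.I := by
    push_cast
    field_simp
  have h₂ : ((2 * π * -(r * -(π * ε)⁻¹) : ℝ) : ℂ) * Complex.I = 2 * (r / ε : ℂ) * Complex.I := by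
    push_cast
    field_simp
  rw [Real.fourierChar_apply, Real.fourierChar_apply, h₁, h₂]
  push_cast
  rw [Complex.cos_sq, Complex.cos]
  ring

/-- for integrable `Φ : ℝ³ → ℂ`,
`lim_{ε→0⁺} ∫ cos²(‖k‖/ε) Φ(k) dk = (1/2) ∫ Φ(k) dk`. -/
theorem oscillatory_cos_squared_averaging
    (Φ : EuclideanSpace ℝ (Fin 3) → ℂ) (hΦ : Integrable Φ) :
    Tendsto (fun ε : ℝ =>
        ∫ k : EuclideanSpace ℝ (Fin 3), ((Real.cos (‖k‖ / ε)) ^ 2 : ℝ) * Φ k)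
      (nhdsWithin 0 (Set.Ioi 0))
      (nhds ((1 / 2 : ℂ) * ∫ k : EuclideanSpace ℝ (Fin 3), Φ k)) := by
  have hRL := tendsto_integral_fourierChar_norm_smul_cocompact volume hΦ
  have hint := integrable_fourierChar_norm_smul hΦ
  have hw : Tendsto (fun ε : ℝ => (π * ε)⁻¹) (nhdsWithin 0 (Set.Ioi 0)) atTop := by
    simp_rw [mul_inv]
    exact tendsto_inv_nhdsGT_zero.const_mul_atTop (inv_pos.2 pi_pos)
  have h₁ := hRL.comp (hw.mono_right atTop_le_cocompact)
  have h₂ := hRL.comp ((tendsto_neg_atTop_atBot.comp hw).mono_right atBot_le_cocompact)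
  have h := ((h₁.add h₂).const_mul (1 / 4 : ℂ)).const_add ((1 / 2 : ℂ) * ∫ k, Φ k)
  rw [add_zero, mul_zero, add_zero] at h
  refine h.congr fun ε => ?_
  have hsum : Integrable fun k => (1 / 4 : ℂ) *
      (Real.fourierChar (-(‖k‖ * (π * ε)⁻¹)) • Φ k +
        Real.fourierChar (-(‖k‖ * -(π * ε)⁻¹)) • Φ k) :=
    ((hint _).add (hint _)).const_mul _
  simp only [Function.comp_apply]
  rw [← integral_add (hint _) (hint _), ← integral_const_mul, ← integral_const_mul,
    ← integral_add (hΦ.const_mul _) hsum]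
  congr 1 with k
  rw [cos_sq_div_eq_fourierChar, Circle.smul_def, Circle.smul_def, smul_eq_mul, smul_eq_mul]
  ring
end
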